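/- arXiv:2506.01722 — 5 statements merged into one kernel-verified Lean document; each statement's English description precedes it below -/
import Mathlib

section
/- (Regret of LoOT-Free OMD, pathwise.) Let α ∈ (0, 1] and β > 0, let ℓ_1, …, ℓ_T ∈ ℝ^K be arbitrary loss vectors, let p_1(i) = 1/K for all i, assume v̄_1 > 0, and suppose that for each t ∈ [T] the vector p_{t+1} minimizes p ↦ ⟨p, ℓ̃_t⟩ + D_t(p ‖ p_t) over P_α. Then for every i* ∈ [K]: Σ_{t=1}^T ⟨p_t − e_{i*}, ℓ_t⟩ ≤ (√(αT) + 5β + (4 + log(K/α))/β)·√(Σ_{t=1}^T v̄_t) + (√(αT) + log(K/α)/β + 2β)·√(Σ_{t=1}^T v_t(i*)). -/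
open Finset

noncomputable section

/-- The probability simplex over `K` experts. -/
def probSimplex (K : ℕ) : Set (Fin K → ℝ) :=
  {q | (∀ i, 0 ≤ q i) ∧ ∑ i, q i = 1}

/-- The probability simplex truncated by `α / K`. -/
def probSimplexTrunc (K : ℕ) (α : ℝ) : Set (Fin K → ℝ) :=
  {q ∈ probSimplex K | ∀ i, α / K ≤ q i}

/-- Instantaneous regret `r_t(i) = ⟨p_t, ℓ_t⟩ - ℓ_t(i)`. -/
def instReg {K : ℕ} (p ℓ : ℕ → Fin K → ℝ) (t : ℕ) (i : Fin K) : ℝ :=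
  (∑ j, p t j * ℓ t j) - ℓ t i

/-- `v_t(i) = r_t(i)²`. -/
def vSq {K : ℕ} (p ℓ : ℕ → Fin K → ℝ) (t : ℕ) (i : Fin K) : ℝ :=
  (instReg p ℓ t i) ^ 2

/-- `v̄_t = Σ_i p_t(i) v_t(i)`. -/
def vBar {K : ℕ} (p ℓ : ℕ → Fin K → ℝ) (t : ℕ) : ℝ :=
  ∑ i, p t i * vSq p ℓ t i

/-- OMD learning rate `η_{t,i} = β / √(max{Σ_{s≤t} v̄_s, Σ_{s≤t} v_s(i)})`. -/
def lrOMD {K : ℕ} (β : ℝ) (p ℓ : ℕ → Fin K → ℝ) (t : ℕ) (i : Fin K) : ℝ :=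
  β / Real.sqrt (max (∑ s ∈ Finset.Icc 1 t, vBar p ℓ s)
                     (∑ s ∈ Finset.Icc 1 t, vSq p ℓ s i))

/-- OMD truncated loss `ℓ̃_t(i) = -r_t(i)·𝟙(|r_t(i)| ≤ 1/η_{t,i})`. -/
def truncOMD {K : ℕ} (β : ℝ) (p ℓ : ℕ → Fin K → ℝ) (t : ℕ) (i : Fin K) : ℝ :=
  if |instReg p ℓ t i| ≤ 1 / lrOMD β p ℓ t i then -instReg p ℓ t i else 0

/-- Bregman divergence `D(x ‖ y) = Σ_i (1/η_i)(x_i log(x_i/y_i) - x_i + y_i)`. -/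
def bregD {K : ℕ} (η : Fin K → ℝ) (x y : Fin K → ℝ) : ℝ :=
  ∑ i, (1 / η i) * (x i * Real.log (x i / y i) - x i + y i)

/-- The scalar generalized relative entropy `x log (x / y) - x + y`. -/
def klScalar (x y : ℝ) : ℝ := x * Real.log (x / y) - x + y

lemma klScalar_nonneg {x y : ℝ} (hx : 0 < x) (hy : 0 < y) : 0 ≤ klScalar x y := by
  have h := Real.one_sub_inv_le_log_of_pos (div_pos hx hy)
  have h2 := mul_le_mul_of_nonneg_left h hx.le
  have h3 : x * (1 - (x / y)⁻¹) = x - y := by field_simp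
  unfold klScalar
  linarith

lemma klScalar_le_sq_div {x y : ℝ} (hx : 0 < x) (hy : 0 < y) :
    klScalar x y ≤ (x - y) ^ 2 / y := by
  have h := Real.log_le_sub_one_of_pos (div_pos hx hy)
  have h2 := mul_le_mul_of_nonneg_left h hx.le
  have h3 : x * (x / y - 1) - x + y = (x - y) ^ 2 / y := by field_simp; ring
  unfold klScalar
  linarith

lemma klScalar_three_point {x y z : ℝ} (hx : 0 < x) (hy : 0 < y) (hz : 0 < z) :
    klScalar x z = klScalar y z + Real.log (y / z) * (x - y) + klScalar x y := by
  unfold klScalar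
  rw [Real.log_div hx.ne' hz.ne', Real.log_div hy.ne' hz.ne', Real.log_div hx.ne' hy.ne']
  ring

lemma klScalar_le_sub {x y : ℝ} (hx : 0 < x) (hxy : x ≤ y) : klScalar x y ≤ y - x := by
  have h := Real.log_nonpos (div_pos hx (hx.trans_le hxy)).le
    ((div_le_one (hx.trans_le hxy)).2 hxy)
  have := mul_nonpos_of_nonneg_of_nonpos hx.le h
  unfold klScalar
  linarith

lemma klScalar_le_log_inv {a x y : ℝ} (ha : 0 < a) (hax : a ≤ x) (hay : a ≤ y)
    (hx1 : x ≤ 1) (hy1 : y ≤ 1) : klScalar x y ≤ Real.log a⁻¹ := by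
  have hx := ha.trans_le hax
  have hy := ha.trans_le hay
  rcases le_total x y with h | h
  · have h1 := klScalar_le_sub hx h
    have h2 := Real.one_sub_inv_le_log_of_pos (inv_pos.2 ha)
    rw [inv_inv] at h2
    linarith
  · have h0 : 0 ≤ Real.log (x / y) := Real.log_nonneg ((one_le_div hy).2 h)
    have h1 : Real.log (x / y) ≤ Real.log a⁻¹ := by
      apply Real.log_le_log (div_pos hx hy)
      rw [div_le_iff₀ hy, inv_mul_eq_div]
      exact hx1.trans ((one_le_div ha).2 hay)
    have h2 : x * Real.log (x / y) ≤ Real.log (x / y) := mul_le_of_le_one_left h0 hx1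
    unfold klScalar
    linarith

lemma sub_mul_sub_klScalar_le {x y w L : ℝ} (hx : 0 < x) (hy : 0 < y) (hw : 0 < w)
    (hL : |L| ≤ w) : (y - x) * L - w * klScalar x y ≤ y * (L ^ 2 / w) := by
  set c : ℝ := -L / w with hc
  have hLc : L = -(w * c) := by rw [hc]; field_simp
  have hc1 : |c| ≤ 1 := by
    rw [hc, abs_div, abs_neg, abs_of_pos hw]
    exact (div_le_one hw).2 hL
  have he := (abs_le.1 (Real.abs_exp_sub_one_sub_id_le hc1)).2
  have hk := klScalar_nonneg hx (mul_pos hy (Real.exp_pos c))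
  have hk2 : klScalar x (y * Real.exp c)
      = klScalar x y - x * c - y + y * Real.exp c := by
    unfold klScalar
    rw [Real.log_div hx.ne' (mul_pos hy (Real.exp_pos c)).ne', Real.log_div hx.ne' hy.ne',
      Real.log_mul hy.ne' (Real.exp_pos c).ne', Real.log_exp]
    ring
  rw [hk2] at hk
  have h1 := mul_le_mul_of_nonneg_left he (mul_pos hw hy).le
  have h2 := mul_nonneg hw.le hk
  have h3 : y * (L ^ 2 / w) = w * y * c ^ 2 := by rw [hLc]; field_simp
  rw [h3, hLc]
  nlinarith

/-- First-order optimality of an entropic mirror-descent step over the truncated simplex. -/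
lemma mirror_step_le {K : ℕ} {α : ℝ} (hα : 0 < α) {L w x y u : Fin K → ℝ}
    (hw : ∀ i, 0 < w i) (hx : ∀ i, 0 < x i)
    (hy : y ∈ probSimplexTrunc K α) (hu : u ∈ probSimplexTrunc K α)
    (hmin : ∀ q ∈ probSimplexTrunc K α,
      (∑ i, y i * L i) + ∑ i, w i * klScalar (y i) (x i)
        ≤ (∑ i, q i * L i) + ∑ i, w i * klScalar (q i) (x i)) :
    (∑ i, (y i - u i) * L i) + ∑ i, w i * klScalar (y i) (x i)
      ≤ ∑ i, w i * (klScalar (u i) (x i) - klScalar (u i) (y i)) := by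
  have pos : ∀ q ∈ probSimplexTrunc K α, ∀ i, 0 < q i := fun q hq i =>
    (div_pos hα (Nat.cast_pos.2 i.pos)).trans_le (hq.2 i)
  have hy0 := pos y hy
  set G : ℝ := ∑ i, (L i + w i * Real.log (y i / x i)) * (u i - y i) with hG
  set C : ℝ := ∑ i, w i * ((u i - y i) ^ 2 / y i) with hC
  have key : ∀ s ∈ Set.Ioc (0 : ℝ) 1, 0 ≤ G + s * C := by
    rintro s ⟨hs0, hs1⟩
    have hq : (fun i => y i + s * (u i - y i)) ∈ probSimplexTrunc K α := by
      have hb : ∀ i, α / K ≤ y i + s * (u i - y i) := fun i => by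
        nlinarith [hy.2 i, hu.2 i]
      refine ⟨⟨fun i => ?_, ?_⟩, hb⟩
      · exact le_trans (by positivity) (hb i)
      · rw [Finset.sum_add_distrib, ← Finset.mul_sum, Finset.sum_sub_distrib, hy.1.2, hu.1.2]
        ring
    have hq0 := pos _ hq
    have h1 := hmin _ hq
    have h2 : (∑ i, (y i + s * (u i - y i)) * L i)
        + ∑ i, w i * klScalar (y i + s * (u i - y i)) (x i)
        ≤ (∑ i, y i * L i) + (∑ i, w i * klScalar (y i) (x i)) + s * (G + s * C) := by
      rw [hG, hC, Finset.mul_sum, ← Finset.sum_add_distrib, ← Finset.sum_add_distrib,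
        ← Finset.sum_add_distrib, Finset.mul_sum, ← Finset.sum_add_distrib]
      refine Finset.sum_le_sum fun i _ => ?_
      have h3 := klScalar_three_point (hq0 i) (hy0 i) (hx i)
      have h4 := mul_le_mul_of_nonneg_left (klScalar_le_sq_div (hq0 i) (hy0 i)) (hw i).le
      have h5 : (y i + s * (u i - y i) - y i) ^ 2 / y i
          = s * (s * ((u i - y i) ^ 2 / y i)) := by ring
      rw [h5] at h4
      rw [h3]
      linarith
    have h6 : 0 ≤ s * (G + s * C) := by linarith
    exact nonneg_of_mul_nonneg_right h6 hs0
  have hC0 : 0 ≤ C := Finset.sum_nonneg fun i _ =>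
    mul_nonneg (hw i).le (div_nonneg (sq_nonneg _) (hy0 i).le)
  have hG0 : 0 ≤ G := by
    by_contra! hneg
    have hd : 0 < 2 * (C - G) := by linarith
    have h := key (-G / (2 * (C - G))) ⟨div_pos (by linarith) hd, (div_le_one hd).2 (by linarith)⟩
    have h' : -G / (2 * (C - G)) * C ≤ -G / 2 := by
      rw [div_mul_eq_mul_div, div_le_iff₀ hd]
      nlinarith
    linarith
  have hfin : (∑ i, w i * (klScalar (u i) (x i) - klScalar (u i) (y i)))
      = (∑ i, (y i - u i) * L i) + (∑ i, w i * klScalar (y i) (x i)) + G := by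
    rw [hG, ← Finset.sum_add_distrib, ← Finset.sum_add_distrib]
    refine Finset.sum_congr rfl fun i _ => ?_
    rw [klScalar_three_point (pos u hu i) (hy0 i) (hx i)]
    ring
  linarith

lemma sum_div_sqrt_sum_le {a : ℕ → ℝ} (T : ℕ) (ha : ∀ t ∈ Finset.Icc 1 T, 0 ≤ a t) :
    ∑ t ∈ Finset.Icc 1 T, a t / Real.sqrt (∑ s ∈ Finset.Icc 1 t, a s)
      ≤ 2 * Real.sqrt (∑ s ∈ Finset.Icc 1 T, a s) := by
  induction T with
  | zero => simp
  | succ n ih =>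
    have ih := ih fun t ht => ha t (Finset.Icc_subset_Icc_right n.le_succ ht)
    have hA : 0 ≤ ∑ s ∈ Finset.Icc 1 n, a s := Finset.sum_nonneg fun t ht =>
      ha t (Finset.Icc_subset_Icc_right n.le_succ ht)
    have hn : 0 ≤ a (n + 1) := ha _ (by simp)
    rw [Finset.sum_Icc_succ_top (by omega), Finset.sum_Icc_succ_top (by omega)]
    set A := ∑ s ∈ Finset.Icc 1 n, a s
    have hstep : a (n + 1) / Real.sqrt (A + a (n + 1))
        ≤ 2 * Real.sqrt (A + a (n + 1)) - 2 * Real.sqrt A := by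
      have h1 : Real.sqrt A ≤ Real.sqrt (A + a (n + 1)) := Real.sqrt_le_sqrt (by linarith)
      rcases (Real.sqrt_nonneg (A + a (n + 1))).eq_or_lt with h0 | h0
      · rw [← h0] at h1 ⊢
        simp only [div_zero]
        linarith
      · rw [div_le_iff₀ h0]
        have h2 := Real.sq_sqrt hA
        have h3 := Real.sq_sqrt (add_nonneg hA hn)
        nlinarith [sq_nonneg (Real.sqrt (A + a (n + 1)) - Real.sqrt A)]
    linarith

lemma sum_mul_sub_succ_eq (w H : ℕ → ℝ) (T : ℕ) :
    ∑ t ∈ Finset.Icc 1 T, w t * (H t - H (t + 1))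
      = (∑ t ∈ Finset.Icc 1 T, (w t - w (t - 1)) * H t) + w 0 * H 1 - w T * H (T + 1) := by
  induction T with
  | zero => simp
  | succ n ih =>
    rw [Finset.sum_Icc_succ_top (by omega), Finset.sum_Icc_succ_top (by omega), ih,
      Nat.add_sub_cancel]
    ring

lemma sum_sub_pred_eq (w : ℕ → ℝ) (T : ℕ) :
    ∑ t ∈ Finset.Icc 1 T, (w t - w (t - 1)) = w T - w 0 := by
  induction T with
  | zero => simp
  | succ n ih =>
    rw [Finset.sum_Icc_succ_top (by omega), ih, Nat.add_sub_cancel]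
    ring

lemma sqrt_sub_sqrt_le_div {x y : ℝ} (hx : 0 ≤ x) (hxy : x ≤ y) :
    Real.sqrt y - Real.sqrt x ≤ (y - x) / Real.sqrt y := by
  have h1 : Real.sqrt x ≤ Real.sqrt y := Real.sqrt_le_sqrt hxy
  rcases (Real.sqrt_nonneg y).eq_or_lt with h0 | h0
  · rw [← h0]
    simp only [div_zero]
    linarith [Real.sqrt_nonneg x]
  · rw [le_div_iff₀ h0]
    nlinarith [Real.sq_sqrt hx, Real.sq_sqrt (hx.trans hxy), Real.sqrt_nonneg x]

lemma sum_abs_le_sqrt_mul_sqrt (f : ℕ → ℝ) (T : ℕ) :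
    ∑ t ∈ Finset.Icc 1 T, |f t| ≤ Real.sqrt T * Real.sqrt (∑ t ∈ Finset.Icc 1 T, f t ^ 2) := by
  have h := Real.sum_mul_le_sqrt_mul_sqrt (Finset.Icc 1 T) (fun _ => 1) (fun t => |f t|)
  simpa using h

/-- One round of clipped entropic mirror descent: `r` are the regrets, `1 / w` the learning
rates, and the comparator is the mixture of a vertex with the uniform distribution. -/
lemma clipped_round_le {K : ℕ} {α : ℝ} (hα0 : 0 < α) (hα1 : α ≤ 1) {r w x y : Fin K → ℝ}
    (hw : ∀ i, 0 < w i) (hx : x ∈ probSimplexTrunc K α) (hy : y ∈ probSimplexTrunc K α)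
    (hr : ∑ i, x i * r i = 0) (k : Fin K) {L u : Fin K → ℝ}
    (hL : ∀ i, L i = if |r i| ≤ w i then -r i else 0)
    (hu : ∀ i, u i = α / K + if i = k then 1 - α else 0)
    (hmin : ∀ q ∈ probSimplexTrunc K α,
      (∑ i, y i * L i) + ∑ i, w i * klScalar (y i) (x i)
        ≤ (∑ i, q i * L i) + ∑ i, w i * klScalar (q i) (x i)) :
    r k ≤ |r k| * Real.sqrt α + Real.sqrt α * Real.sqrt (∑ i, x i * r i ^ 2)
      + ∑ i, w i * (klScalar (u i) (x i) - klScalar (u i) (y i))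
      + 2 * (∑ i, x i * (r i ^ 2 / w i)) + r k ^ 2 / w k := by
  have hK : (0 : ℝ) < K := Nat.cast_pos.2 k.pos
  have ha : 0 < α / K := div_pos hα0 hK
  have hx0 : ∀ i, 0 < x i := fun i => ha.trans_le (hx.2 i)
  have hy0 : ∀ i, 0 < y i := fun i => ha.trans_le (hy.2 i)
  have hαK : α / K ≤ α := div_le_self hα0.le (by exact_mod_cast k.pos)
  have huP : u ∈ probSimplexTrunc K α := by
    have hb : ∀ i, α / K ≤ u i := fun i => by
      rw [hu]
      split_ifs <;> linarith
    refine ⟨⟨fun i => ha.le.trans (hb i), ?_⟩, hb⟩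
    simp only [hu, Finset.sum_add_distrib, Finset.sum_ite_eq', Finset.mem_univ, if_true,
      Finset.sum_const, Finset.card_univ, Fintype.card_fin, nsmul_eq_mul]
    field_simp
    ring
  have hstep := mirror_step_le hα0 hw hx0 hy huP hmin
  have hstab : (∑ i, (x i - y i) * L i) - ∑ i, w i * klScalar (y i) (x i)
      ≤ ∑ i, x i * (r i ^ 2 / w i) := by
    rw [← Finset.sum_sub_distrib]
    refine Finset.sum_le_sum fun i _ => ?_
    have hLw : |L i| ≤ w i := by
      rw [hL]
      split_ifs with h
      · rwa [abs_neg]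
      · simpa using (hw i).le
    refine (sub_mul_sub_klScalar_le (hy0 i) (hx0 i) (hw i) hLw).trans ?_
    have hLr : L i ^ 2 ≤ r i ^ 2 := by
      rw [hL]
      split_ifs
      · simp
      · simpa using sq_nonneg (r i)
    exact mul_le_mul_of_nonneg_left (div_le_div_of_nonneg_right hLr (hw i).le) (hx0 i).le
  have htrunc : ∑ i, (u i - x i) * (r i + L i)
      ≤ (∑ i, x i * (r i ^ 2 / w i)) + r k ^ 2 / w k := by
    have hsplit : r k ^ 2 / w k = ∑ i, if i = k then r i ^ 2 / w i else 0 := by simp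
    rw [hsplit, ← Finset.sum_add_distrib]
    refine Finset.sum_le_sum fun i _ => ?_
    have hq : 0 ≤ r i ^ 2 / w i := div_nonneg (sq_nonneg _) (hw i).le
    have he : |r i + L i| ≤ r i ^ 2 / w i := by
      rw [hL]
      split_ifs with h
      · simpa using hq
      · push Not at h
        rw [add_zero, le_div_iff₀ (hw i), ← sq_abs]
        nlinarith [abs_nonneg (r i)]
    have hx1 := hx.2 i
    have hc : |u i - x i| ≤ x i + if i = k then 1 else 0 := by
      rw [hu, abs_le]
      split_ifs <;> constructor <;> linarith
    calc (u i - x i) * (r i + L i) ≤ |u i - x i| * |r i + L i| := by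
          rw [← abs_mul]; exact le_abs_self _
      _ ≤ (x i + if i = k then 1 else 0) * (r i ^ 2 / w i) :=
          mul_le_mul hc he (abs_nonneg _) ((abs_nonneg _).trans hc)
      _ = _ := by split_ifs <;> ring
  have hdecomp : ∑ i, u i * r i = (∑ i, (x i - y i) * L i) + (∑ i, (y i - u i) * L i)
      + ∑ i, (u i - x i) * (r i + L i) := by
    have h : (∑ i, (x i - y i) * L i) + (∑ i, (y i - u i) * L i)
      + ∑ i, (u i - x i) * (r i + L i) = ∑ i, u i * r i - ∑ i, x i * r i := by
      rw [← Finset.sum_add_distrib, ← Finset.sum_add_distrib, ← Finset.sum_sub_distrib]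
      exact Finset.sum_congr rfl fun i _ => by ring
    rw [h, hr, sub_zero]
  have hur : ∑ i, u i * r i = (∑ i, α / K * r i) + (1 - α) * r k := by
    simp [hu, add_mul, Finset.sum_add_distrib]
  have hunif : -(∑ i, α / K * r i) ≤ Real.sqrt α * Real.sqrt (∑ i, x i * r i ^ 2) := by
    have h := Real.sum_mul_le_sqrt_mul_sqrt Finset.univ (fun _ : Fin K => Real.sqrt (α / K))
      (fun i => Real.sqrt (α / K) * -r i)
    have h1 : ∑ _i : Fin K, Real.sqrt (α / K) ^ 2 = α := by
      simp only [Real.sq_sqrt ha.le, Finset.sum_const, Finset.card_univ, Fintype.card_fin,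
        nsmul_eq_mul]
      field_simp
    have h2 : ∑ i, (Real.sqrt (α / K) * -r i) ^ 2 ≤ ∑ i, x i * r i ^ 2 := by
      refine Finset.sum_le_sum fun i _ => ?_
      rw [mul_pow, Real.sq_sqrt ha.le, neg_sq]
      exact mul_le_mul_of_nonneg_right (hx.2 i) (sq_nonneg _)
    have h3 : -(∑ i, α / K * r i)
        = ∑ i, Real.sqrt (α / K) * (Real.sqrt (α / K) * -r i) := by
      rw [← Finset.sum_neg_distrib]
      refine Finset.sum_congr rfl fun i _ => ?_
      rw [← mul_assoc, Real.mul_self_sqrt ha.le]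
      ring
    rw [h1] at h
    rw [h3]
    exact h.trans (mul_le_mul_of_nonneg_left (Real.sqrt_le_sqrt h2) (Real.sqrt_nonneg _))
  have hvert : α * r k ≤ |r k| * Real.sqrt α := by
    have hs : α ≤ Real.sqrt α := Real.le_sqrt_of_sq_le (by nlinarith)
    calc α * r k ≤ α * |r k| := mul_le_mul_of_nonneg_left (le_abs_self _) hα0.le
      _ ≤ |r k| * Real.sqrt α := by
        rw [mul_comm]; exact mul_le_mul_of_nonneg_left hs (abs_nonneg _)
  linarith

theorem stmt_6 (K T : ℕ) (hK : 2 ≤ K) (hT : 2 ≤ T) (α β : ℝ)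
    (hα : α ∈ Set.Ioc (0 : ℝ) 1) (hβ : 0 < β)
    (ℓ p : ℕ → Fin K → ℝ)
    (hp1 : ∀ i, p 1 i = 1 / K)
    (hv1 : 0 < vBar p ℓ 1)
    (hmin : ∀ t ∈ Finset.Icc 1 T,
      p (t + 1) ∈ probSimplexTrunc K α ∧
      ∀ q ∈ probSimplexTrunc K α,
        (∑ i, p (t + 1) i * truncOMD β p ℓ t i)
            + bregD (lrOMD β p ℓ t) (p (t + 1)) (p t)
          ≤ (∑ i, q i * truncOMD β p ℓ t i) + bregD (lrOMD β p ℓ t) q (p t)) :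
    ∀ istar : Fin K,
      ∑ t ∈ Finset.Icc 1 T, ((∑ j, p t j * ℓ t j) - ℓ t istar)
        ≤ (Real.sqrt (α * T) + 5 * β + (4 + Real.log (K / α)) / β)
            * Real.sqrt (∑ t ∈ Finset.Icc 1 T, vBar p ℓ t)
          + (Real.sqrt (α * T) + Real.log (K / α) / β + 2 * β)
            * Real.sqrt (∑ t ∈ Finset.Icc 1 T, vSq p ℓ t istar) := by
  obtain ⟨hα0, hα1⟩ := hα
  intro k
  have hK0 : (0 : ℝ) < K := Nat.cast_pos.2 k.pos
  have ha : 0 < α / K := div_pos hα0 hK0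
  have ha1 : α / K ≤ α := div_le_self hα0.le (by exact_mod_cast k.pos)
  have hP : ∀ t ∈ Finset.Icc 1 (T + 1), p t ∈ probSimplexTrunc K α := by
    intro t ht
    obtain ⟨h1, h2⟩ := Finset.mem_Icc.1 ht
    rcases h1.eq_or_lt with rfl | h1
    · refine ⟨⟨fun i => ?_, ?_⟩, fun i => ?_⟩
      · rw [hp1]; positivity
      · simp [hp1, hK0.ne']
      · rw [hp1]; exact div_le_div_of_nonneg_right hα1 hK0.le
    · obtain ⟨s, rfl⟩ : ∃ s, t = s + 1 := ⟨t - 1, by omega⟩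
      exact (hmin s (Finset.mem_Icc.2 ⟨by omega, by omega⟩)).1
  have hp0 : ∀ t ∈ Finset.Icc 1 (T + 1), ∀ i, 0 < p t i := fun t ht i =>
    ha.trans_le ((hP t ht).2 i)
  have hple : ∀ t ∈ Finset.Icc 1 (T + 1), ∀ i, p t i ≤ 1 := fun t ht i => by
    rw [← (hP t ht).1.2]
    exact Finset.single_le_sum (fun j _ => (hP t ht).1.1 j) (Finset.mem_univ i)
  have hsub : ∀ t ∈ Finset.Icc 1 T, t ∈ Finset.Icc 1 (T + 1) := fun t ht =>
    Finset.Icc_subset_Icc_right T.le_succ ht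
  have hv0 : ∀ t i, 0 ≤ vSq p ℓ t i := fun t i => sq_nonneg _
  have hb0 : ∀ t ∈ Finset.Icc 1 T, 0 ≤ vBar p ℓ t := fun t ht =>
    Finset.sum_nonneg fun i _ => mul_nonneg (hp0 t (hsub t ht) i).le (hv0 t i)
  set B : ℕ → ℝ := fun t => ∑ s ∈ Finset.Icc 1 t, vBar p ℓ s with hB
  set V : ℕ → Fin K → ℝ := fun t i => ∑ s ∈ Finset.Icc 1 t, vSq p ℓ s i with hV
  set w : ℕ → Fin K → ℝ := fun t i => 1 / lrOMD β p ℓ t i with hw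
  have hwM : ∀ t i, w t i = Real.sqrt (max (B t) (V t i)) / β := fun t i => one_div_div _ _
  have hw00 : ∀ i, w 0 i = 0 := fun i => by simp [hwM, hB, hV]
  have hBs : ∀ t ∈ Finset.Icc 1 T, B t = B (t - 1) + vBar p ℓ t := by
    intro t ht
    obtain ⟨s, rfl⟩ : ∃ s, t = s + 1 := ⟨t - 1, by have := (Finset.mem_Icc.1 ht).1; omega⟩
    exact Finset.sum_Icc_succ_top (by omega) _
  have hVs : ∀ t ∈ Finset.Icc 1 T, ∀ i, V t i = V (t - 1) i + vSq p ℓ t i := by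
    intro t ht i
    obtain ⟨s, rfl⟩ : ∃ s, t = s + 1 := ⟨t - 1, by have := (Finset.mem_Icc.1 ht).1; omega⟩
    exact Finset.sum_Icc_succ_top (by omega) _
  have hV0 : ∀ t i, 0 ≤ V t i := fun t i => Finset.sum_nonneg fun s _ => hv0 s i
  have hBpos : ∀ t ∈ Finset.Icc 1 T, 0 < B t := by
    intro t ht
    obtain ⟨h1, h2⟩ := Finset.mem_Icc.1 ht
    exact hv1.trans_le (Finset.single_le_sum (f := fun s => vBar p ℓ s)
      (fun s hs => hb0 s (Finset.Icc_subset_Icc_right h2 hs)) (Finset.mem_Icc.2 ⟨le_rfl, h1⟩))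
  have hwpos : ∀ t ∈ Finset.Icc 1 T, ∀ i, 0 < w t i := fun t ht i => by
    rw [hwM]
    exact div_pos (Real.sqrt_pos.2 ((hBpos t ht).trans_le (le_max_left _ _))) hβ
  have hr0 : ∀ t ∈ Finset.Icc 1 T, ∑ i, p t i * instReg p ℓ t i = 0 := fun t ht => by
    simp only [instReg, mul_sub, Finset.sum_sub_distrib, ← Finset.sum_mul,
      (hP t (hsub t ht)).1.2]
    ring
  have hdiff : ∀ t ∈ Finset.Icc 1 T, ∀ i, 0 ≤ w t i - w (t - 1) i ∧
      w t i - w (t - 1) i ≤ (vBar p ℓ t + vSq p ℓ t i) / Real.sqrt (B t) / β := by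
    intro t ht i
    have h1 := hb0 t ht
    have h2 := hv0 t i
    have hle : max (B (t - 1)) (V (t - 1) i) ≤ max (B t) (V t i) :=
      max_le_max (by rw [hBs t ht]; linarith) (by rw [hVs t ht]; linarith)
    have hd : max (B t) (V t i) - max (B (t - 1)) (V (t - 1) i)
        ≤ vBar p ℓ t + vSq p ℓ t i := by
      rw [sub_le_iff_le_add]
      refine max_le ?_ ?_
      · linarith [le_max_left (B (t - 1)) (V (t - 1) i), hBs t ht]
      · linarith [le_max_right (B (t - 1)) (V (t - 1) i), hVs t ht i]
    rw [hwM, hwM, ← sub_div]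
    refine ⟨div_nonneg (sub_nonneg.2 (Real.sqrt_le_sqrt hle)) hβ.le,
      div_le_div_of_nonneg_right ?_ hβ.le⟩
    refine (sqrt_sub_sqrt_le_div (le_max_of_le_right (hV0 _ _)) hle).trans ?_
    exact div_le_div₀ (add_nonneg h1 h2) hd (Real.sqrt_pos.2 (hBpos t ht))
      (Real.sqrt_le_sqrt (le_max_left _ _))
  obtain ⟨u, hu⟩ : ∃ u : Fin K → ℝ, ∀ i, u i = α / K + if i = k then 1 - α else 0 :=
    ⟨_, fun _ => rfl⟩
  have hua : ∀ i, α / K ≤ u i := fun i => by rw [hu]; split_ifs <;> linarith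
  have hu1 : ∀ i, u i ≤ 1 := fun i => by rw [hu]; split_ifs <;> linarith
  have hround : ∀ t ∈ Finset.Icc 1 T, instReg p ℓ t k
      ≤ |instReg p ℓ t k| * Real.sqrt α + Real.sqrt α * Real.sqrt (vBar p ℓ t)
        + ∑ i, w t i * (klScalar (u i) (p t i) - klScalar (u i) (p (t + 1) i))
        + 2 * (β * (vBar p ℓ t / Real.sqrt (B t)))
        + β * (vSq p ℓ t k / Real.sqrt (V t k)) := by
    intro t ht
    have h := clipped_round_le hα0 hα1 (hwpos t ht) (hP t (hsub t ht)) (hmin t ht).1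
      (hr0 t ht) k (L := truncOMD β p ℓ t) (u := u) (fun i => rfl) hu (hmin t ht).2
    have h1 : ∑ i, p t i * (instReg p ℓ t i ^ 2 / w t i)
        ≤ β * (vBar p ℓ t / Real.sqrt (B t)) := by
      have hBt := Real.sqrt_pos.2 (hBpos t ht)
      rw [vBar, Finset.sum_div, Finset.mul_sum]
      refine Finset.sum_le_sum fun i _ => ?_
      have hle : Real.sqrt (B t) / β ≤ w t i := by
        rw [hwM]
        exact div_le_div_of_nonneg_right (Real.sqrt_le_sqrt (le_max_left _ _)) hβ.le
      have := div_le_div_of_nonneg_left (hv0 t i) (div_pos hBt hβ) hle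
      have h3 := mul_le_mul_of_nonneg_left this (hp0 t (hsub t ht) i).le
      refine h3.trans (le_of_eq ?_)
      field_simp
    have h2 : instReg p ℓ t k ^ 2 / w t k ≤ β * (vSq p ℓ t k / Real.sqrt (V t k)) := by
      change vSq p ℓ t k / w t k ≤ _
      rcases (hV0 t k).eq_or_lt with h0 | h0
      · have hz : vSq p ℓ t k = 0 := by
          linarith [hVs t ht k, hv0 t k, hV0 (t - 1) k]
        simp [hz]
      · have hs := Real.sqrt_pos.2 h0
        have hle : Real.sqrt (V t k) / β ≤ w t k := by
          rw [hwM]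
          exact div_le_div_of_nonneg_right (Real.sqrt_le_sqrt (le_max_right _ _)) hβ.le
        refine (div_le_div_of_nonneg_left (hv0 t k) (div_pos hs hβ) hle).trans (le_of_eq ?_)
        field_simp
    have h3 : ∑ i, p t i * instReg p ℓ t i ^ 2 = vBar p ℓ t := rfl
    rw [h3] at h
    linarith
  have hsumB := sum_div_sqrt_sum_le T hb0
  have hsumV := sum_div_sqrt_sum_le T (a := fun t => vSq p ℓ t k) fun t _ => hv0 t k
  have hvert : ∑ t ∈ Finset.Icc 1 T, |instReg p ℓ t k| ≤ Real.sqrt T * Real.sqrt (V T k) :=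
    sum_abs_le_sqrt_mul_sqrt (fun t => instReg p ℓ t k) T
  have hunif : ∑ t ∈ Finset.Icc 1 T, Real.sqrt (vBar p ℓ t)
      ≤ Real.sqrt T * Real.sqrt (B T) := by
    have h := sum_abs_le_sqrt_mul_sqrt (fun t => Real.sqrt (vBar p ℓ t)) T
    rwa [Finset.sum_congr rfl fun t _ => abs_of_nonneg (Real.sqrt_nonneg _),
      Finset.sum_congr rfl fun t ht => Real.sq_sqrt (hb0 t ht)] at h
  have hBT0 : 0 ≤ B T := Finset.sum_nonneg hb0
  have hlog : (α / K)⁻¹ = K / α := inv_div _ _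
  have hlog0 : 0 ≤ Real.log (K / α) := by
    rw [← hlog]
    exact Real.log_nonneg ((one_le_inv₀ ha).2 (ha1.trans hα1))
  have habel : ∀ i, ∑ t ∈ Finset.Icc 1 T,
      w t i * (klScalar (u i) (p t i) - klScalar (u i) (p (t + 1) i))
      ≤ ∑ t ∈ Finset.Icc 1 T, (w t i - w (t - 1) i) * klScalar (u i) (p t i) := by
    intro i
    rw [sum_mul_sub_succ_eq (fun t => w t i) (fun t => klScalar (u i) (p t i)) T, hw00]
    have h1 := klScalar_nonneg (ha.trans_le (hua i))
      (hp0 (T + 1) (Finset.mem_Icc.2 ⟨by omega, le_rfl⟩) i)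
    have h2 := mul_nonneg (hwpos T (Finset.mem_Icc.2 ⟨by omega, le_rfl⟩) i).le h1
    linarith
  have hterm : ∀ t ∈ Finset.Icc 1 T, ∀ i, (w t i - w (t - 1) i) * klScalar (u i) (p t i)
      ≤ p t i * ((vBar p ℓ t + vSq p ℓ t i) / Real.sqrt (B t) / β)
        + if i = k then (w t i - w (t - 1) i) * Real.log (K / α) else 0 := by
    intro t ht i
    obtain ⟨hd0, hd1⟩ := hdiff t ht i
    have hpa := (hP t (hsub t ht)).2 i
    split_ifs with hik
    · have h1 := klScalar_le_log_inv ha (hua i) hpa (hu1 i) (hple t (hsub t ht) i)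
      rw [hlog] at h1
      have h2 := mul_le_mul_of_nonneg_left h1 hd0
      have h3 := mul_nonneg (hp0 t (hsub t ht) i).le (hd0.trans hd1)
      linarith
    · have hui : u i = α / K := by rw [hu, if_neg hik, add_zero]
      have h1 : klScalar (u i) (p t i) ≤ p t i := by
        rw [hui]
        linarith [klScalar_le_sub ha hpa]
      have h2 := mul_le_mul_of_nonneg_left h1 hd0
      have h3 := mul_le_mul_of_nonneg_left hd1 (hp0 t (hsub t ht) i).le
      linarith
  have hbreg : ∑ t ∈ Finset.Icc 1 T, ∑ i,
      w t i * (klScalar (u i) (p t i) - klScalar (u i) (p (t + 1) i))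
      ≤ 4 / β * Real.sqrt (B T)
        + Real.log (K / α) / β * (Real.sqrt (B T) + Real.sqrt (V T k)) := by
    have hinner : ∀ t ∈ Finset.Icc 1 T,
        ∑ i, p t i * ((vBar p ℓ t + vSq p ℓ t i) / Real.sqrt (B t) / β)
          = 2 / β * (vBar p ℓ t / Real.sqrt (B t)) := by
      intro t ht
      have h1 : ∑ i, p t i * ((vBar p ℓ t + vSq p ℓ t i) / Real.sqrt (B t) / β)
          = (vBar p ℓ t * (∑ i, p t i) + ∑ i, p t i * vSq p ℓ t i)
            / Real.sqrt (B t) / β := by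
        rw [Finset.mul_sum, ← Finset.sum_add_distrib, Finset.sum_div, Finset.sum_div]
        exact Finset.sum_congr rfl fun i _ => by ring
      rw [h1, (hP t (hsub t ht)).1.2, ← vBar]
      ring
    have hlast : w T k ≤ (Real.sqrt (B T) + Real.sqrt (V T k)) / β := by
      rw [hwM]
      refine div_le_div_of_nonneg_right ?_ hβ.le
      rcases max_choice (B T) (V T k) with h | h <;> rw [h] <;>
        linarith [Real.sqrt_nonneg (B T), Real.sqrt_nonneg (V T k)]
    calc _ = ∑ i, ∑ t ∈ Finset.Icc 1 T,
          w t i * (klScalar (u i) (p t i) - klScalar (u i) (p (t + 1) i)) := Finset.sum_comm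
      _ ≤ ∑ i, ∑ t ∈ Finset.Icc 1 T, (w t i - w (t - 1) i) * klScalar (u i) (p t i) :=
        Finset.sum_le_sum fun i _ => habel i
      _ = ∑ t ∈ Finset.Icc 1 T, ∑ i, (w t i - w (t - 1) i) * klScalar (u i) (p t i) :=
        Finset.sum_comm
      _ ≤ ∑ t ∈ Finset.Icc 1 T, (2 / β * (vBar p ℓ t / Real.sqrt (B t))
          + (w t k - w (t - 1) k) * Real.log (K / α)) := by
        refine Finset.sum_le_sum fun t ht =>
          (Finset.sum_le_sum fun i _ => hterm t ht i).trans (le_of_eq ?_)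
        rw [Finset.sum_add_distrib, hinner t ht]
        simp
      _ = 2 / β * (∑ t ∈ Finset.Icc 1 T, vBar p ℓ t / Real.sqrt (B t))
          + w T k * Real.log (K / α) := by
        rw [Finset.sum_add_distrib, ← Finset.mul_sum, ← Finset.sum_mul,
          sum_sub_pred_eq (fun t => w t k), hw00, sub_zero]
      _ ≤ 2 / β * (2 * Real.sqrt (B T))
          + (Real.sqrt (B T) + Real.sqrt (V T k)) / β * Real.log (K / α) :=
        add_le_add (mul_le_mul_of_nonneg_left hsumB (by positivity))
          (mul_le_mul_of_nonneg_right hlast hlog0)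
      _ = _ := by ring
  have htotal := Finset.sum_le_sum hround
  simp only [Finset.sum_add_distrib, ← Finset.mul_sum, ← Finset.sum_mul] at htotal
  have hαT : Real.sqrt (α * T) = Real.sqrt α * Real.sqrt T := Real.sqrt_mul hα0.le _
  have e1 := mul_le_mul_of_nonneg_left hvert (Real.sqrt_nonneg α)
  have e2 := mul_le_mul_of_nonneg_left hunif (Real.sqrt_nonneg α)
  have e3 := mul_le_mul_of_nonneg_left hsumB hβ.le
  have e4 := mul_le_mul_of_nonneg_left hsumV hβ.le
  have e5 := mul_nonneg hβ.le (Real.sqrt_nonneg (B T))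
  change ∑ t ∈ Finset.Icc 1 T, instReg p ℓ t k ≤ _ * Real.sqrt (B T) + _ * Real.sqrt (V T k)
  change β * (∑ t ∈ Finset.Icc 1 T, vSq p ℓ t k / Real.sqrt (V t k))
    ≤ β * (2 * Real.sqrt (V T k)) at e4
  have hrhs : (Real.sqrt (α * T) + 5 * β + (4 + Real.log (K / α)) / β) * Real.sqrt (B T)
      + (Real.sqrt (α * T) + Real.log (K / α) / β + 2 * β) * Real.sqrt (V T k)
      = Real.sqrt α * (Real.sqrt T * Real.sqrt (B T))
        + Real.sqrt α * (Real.sqrt T * Real.sqrt (V T k))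
        + (4 / β * Real.sqrt (B T)
          + Real.log (K / α) / β * (Real.sqrt (B T) + Real.sqrt (V T k)))
        + 5 * (β * Real.sqrt (B T)) + β * (2 * Real.sqrt (V T k)) := by
    rw [hαT]
    ring
  rw [hrhs]
  linarith
end
end

section
/- (Regret of LoOT-Free FTRL, pathwise.) Let β > 0, let ℓ_1, …, ℓ_T ∈ ℝ^K be arbitrary loss vectors, let p_1(i) = 1/K for all i, assume v̄_1 > 0, and suppose that for each t ∈ [T] the vector p_{t+1} minimizes p ↦ Σ_{s=1}^t ⟨p, ℓ̃_s⟩ + D_t(p ‖ p_1) over P. Then for every i* ∈ [K]: Σ_{t=1}^T ⟨p_t − e_{i*}, ℓ_t⟩ ≤ (log(K)/β + 2β)·√(Σ_{t=1}^T v_t(i*)) + ((5 + log(K))/β + 5β)·√(Σ_{t=1}^T v̄_t) + (1/β)·(1/K)·Σ_{i=1}^K √(Σ_{t=1}^T v_t(i)). -/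
open Finset

noncomputable section

/-- `b_t(i) = √(max{Σ_{s≤t} v̄_s, Σ_{s≤t} v_s(i)})`; note `b_0(i) = 0`. -/
def bFTRL {K : ℕ} (p ℓ : ℕ → Fin K → ℝ) (t : ℕ) (i : Fin K) : ℝ :=
  Real.sqrt (max (∑ s ∈ Finset.Icc 1 t, vBar p ℓ s)
                 (∑ s ∈ Finset.Icc 1 t, vSq p ℓ s i))

/-- FTRL learning rate `η_{t,i} = β / b_t(i)`. -/
def lrFTRL {K : ℕ} (β : ℝ) (p ℓ : ℕ → Fin K → ℝ) (t : ℕ) (i : Fin K) : ℝ :=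
  β / bFTRL p ℓ t i

/-- FTRL truncated loss
`ℓ̃_t(i) = -r_t(i)·(b_{t-1}(i)/b_t(i))·𝟙(|r_t(i)| ≤ 1/η_{t,i})`. -/
def truncFTRL {K : ℕ} (β : ℝ) (p ℓ : ℕ → Fin K → ℝ) (t : ℕ) (i : Fin K) : ℝ :=
  if |instReg p ℓ t i| ≤ 1 / lrFTRL β p ℓ t i then
    -instReg p ℓ t i * (bFTRL p ℓ (t - 1) i / bFTRL p ℓ t i)
  else 0

/-- The summand `x log (x / y) - x + y` of the generalised relative entropy. -/
def klTerm (x y : ℝ) : ℝ := x * Real.log (x / y) - x + y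

lemma bregD_eq_sum_klTerm {K : ℕ} (η x y : Fin K → ℝ) :
    bregD η x y = ∑ i, (1 / η i) * klTerm (x i) (y i) := rfl

lemma mul_log_div_eq {x y : ℝ} (hy : 0 < y) :
    x * Real.log (x / y) = x * Real.log x - x * Real.log y := by
  rcases eq_or_ne x 0 with rfl | hx
  · simp
  · rw [Real.log_div hx hy.ne']; ring

lemma klTerm_nonneg {x y : ℝ} (hx : 0 ≤ x) (hy : 0 < y) : 0 ≤ klTerm x y := by
  unfold klTerm
  rcases hx.eq_or_lt with rfl | hx
  · simpa using hy.le
  · have h := Real.one_sub_inv_le_log_of_pos (div_pos hx hy)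
    have h2 := mul_le_mul_of_nonneg_left h hx.le
    have : x * (1 - (x / y)⁻¹) = x - y := by field_simp
    linarith

lemma klTerm_le_sq_div {x y : ℝ} (hx : 0 ≤ x) (hy : 0 < y) :
    klTerm x y ≤ (x - y) ^ 2 / y := by
  unfold klTerm
  rcases hx.eq_or_lt with rfl | hx
  · apply le_of_eq; field_simp; simp [sq]
  · have h := Real.log_le_sub_one_of_pos (div_pos hx hy)
    have h2 := mul_le_mul_of_nonneg_left h hx.le
    have : x * (x / y - 1) - x + y = (x - y) ^ 2 / y := by field_simp; ring
    linarith

lemma klTerm_three_point {x p y : ℝ} (hp : 0 < p) (hy : 0 < y) :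
    klTerm x y = klTerm p y + (x - p) * Real.log (p / y) + klTerm x p := by
  unfold klTerm
  rw [mul_log_div_eq hy, mul_log_div_eq hp, Real.log_div hp.ne' hy.ne']
  ring

lemma klTerm_mix_le {p y h : ℝ} (hp : 0 ≤ p) (hy : 0 < y) (h0 : 0 ≤ h) (h1 : h ≤ 1) :
    klTerm ((1 - h) * p + h * y) y ≤ (1 - h) * klTerm p y := by
  have hc := Real.convexOn_mul_log.2 (x := p) (y := y) hp hy.le (sub_nonneg.2 h1) h0 (by ring)
  simp only [smul_eq_mul] at hc
  unfold klTerm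
  rw [mul_log_div_eq hy, mul_log_div_eq hy]
  linarith

lemma klTerm_mul_self {y h : ℝ} (hy : 0 < y) :
    klTerm (h * y) y = h * y * Real.log h - h * y + y := by
  unfold klTerm
  rw [mul_div_assoc, div_self hy.ne', mul_one]

/-- One-coordinate stability bound for the entropic regulariser. -/
lemma linear_sub_klTerm_le {p x l c : ℝ} (hp : 0 < p) (hx : 0 ≤ x) (hc : 0 < c) (hl : |l| ≤ c) :
    (p - x) * l - c * klTerm x p ≤ p * (l ^ 2 / c) := by
  set z := l / c with hz
  have hlz : l = c * z := by rw [hz]; field_simp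
  have hz1 : |-z| ≤ 1 := by
    rw [abs_neg, hz, abs_div, abs_of_pos hc]; exact (div_le_one hc).2 hl
  have he := (abs_le.1 (Real.abs_exp_sub_one_sub_id_le hz1)).2
  have hq : 0 < p * Real.exp (-z) := by positivity
  have hk := klTerm_nonneg hx hq
  have h3 : klTerm x (p * Real.exp (-z)) = klTerm x p + x * z - p + p * Real.exp (-z) := by
    unfold klTerm
    rw [mul_log_div_eq hq, mul_log_div_eq hp, Real.log_mul hp.ne' (Real.exp_ne_zero _),
      Real.log_exp]
    ring
  have h4 : (p - x) * z - klTerm x p ≤ p * z ^ 2 := by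
    nlinarith [mul_le_mul_of_nonneg_left he hp.le]
  have h5 := mul_le_mul_of_nonneg_left h4 hc.le
  have h6 : p * (l ^ 2 / c) = c * (p * z ^ 2) := by rw [hlz]; field_simp
  rw [h6, hlz]; linarith

lemma convexCombo_mem_probSimplex {K : ℕ} {p q : Fin K → ℝ} (hp : p ∈ probSimplex K)
    (hq : q ∈ probSimplex K) {h : ℝ} (h0 : 0 ≤ h) (h1 : h ≤ 1) :
    (fun i => (1 - h) * p i + h * q i) ∈ probSimplex K := by
  refine ⟨fun i => add_nonneg (mul_nonneg (by linarith) (hp.1 i)) (mul_nonneg h0 (hq.1 i)), ?_⟩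
  rw [sum_add_distrib, ← mul_sum, ← mul_sum, hp.2, hq.2]; ring

/-- A minimiser of an entropically regularised linear function lies in the interior. -/
lemma regularized_minimizer_pos {K : ℕ} {η L y p : Fin K → ℝ} (hη : ∀ i, 0 < η i)
    (hy : y ∈ probSimplex K) (hy0 : ∀ i, 0 < y i) (hp : p ∈ probSimplex K)
    (hmin : ∀ q ∈ probSimplex K,
      ∑ i, p i * L i + bregD η p y ≤ ∑ i, q i * L i + bregD η q y) (i : Fin K) :
    0 < p i := by
  by_contra hneg
  have hpi : p i = 0 := le_antisymm (not_lt.1 hneg) (hp.1 i)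
  set A : ℝ := ∑ j, y j * L j - ∑ j, p j * L j - bregD η p y with hA
  set c : ℝ := 1 / η i * y i with hc
  have hcpos : 0 < c := mul_pos (one_div_pos.2 (hη i)) (hy0 i)
  set h : ℝ := Real.exp (-((|A| + 1) / c)) with hh
  have hpos : 0 < h := Real.exp_pos _
  have hle : h ≤ 1 := Real.exp_le_one_iff.2 (neg_nonpos.2 (by positivity))
  have hlog : c * Real.log h = -(|A| + 1) := by
    rw [hh, Real.log_exp]; field_simp
  have hm := hmin _ (convexCombo_mem_probSimplex hp hy hpos.le hle)
  have hlin : ∑ j, ((1 - h) * p j + h * y j) * L j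
      = (1 - h) * ∑ j, p j * L j + h * ∑ j, y j * L j := by
    rw [mul_sum, mul_sum, ← sum_add_distrib]
    exact sum_congr rfl fun j _ => by ring
  have hdiv : bregD η (fun j => (1 - h) * p j + h * y j) y
      ≤ (1 - h) * bregD η p y + h * (c * Real.log h) := by
    have hite : h * (c * Real.log h) = ∑ j, if j = i then h * (c * Real.log h) else 0 := by simp
    rw [bregD_eq_sum_klTerm, bregD_eq_sum_klTerm, mul_sum, hite, ← sum_add_distrib]
    refine sum_le_sum fun j _ => ?_
    split_ifs with hji
    · subst hji
      rw [hpi, mul_zero, zero_add, klTerm_mul_self (hy0 j)]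
      apply le_of_eq
      simp only [hc, klTerm]
      ring
    · have := mul_le_mul_of_nonneg_left (klTerm_mix_le (hp.1 j) (hy0 j) hpos.le hle)
        (one_div_pos.2 (hη j)).le
      linarith
  rw [hlin] at hm
  have hfin : 0 ≤ h * (A + c * Real.log h) := by rw [hA]; linarith
  rw [hlog] at hfin
  have : A + -(|A| + 1) < 0 := by linarith [le_abs_self A]
  nlinarith

/-- Strong optimality of the minimiser of an entropically regularised linear function. -/
lemma regularized_minimizer_bregD_le {K : ℕ} {η L y p : Fin K → ℝ} (hη : ∀ i, 0 < η i)
    (hy0 : ∀ i, 0 < y i) (hp : p ∈ probSimplex K) (hp0 : ∀ i, 0 < p i)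
    (hmin : ∀ q ∈ probSimplex K,
      ∑ i, p i * L i + bregD η p y ≤ ∑ i, q i * L i + bregD η q y)
    {x : Fin K → ℝ} (hx : x ∈ probSimplex K) :
    ∑ i, p i * L i + bregD η p y + bregD η x p ≤ ∑ i, x i * L i + bregD η x y := by
  have expand : ∀ q : Fin K → ℝ, ∑ i, q i * L i + bregD η q y
      = ∑ i, p i * L i + bregD η p y
        + ∑ i, (q i - p i) * (L i + 1 / η i * Real.log (p i / y i)) + bregD η q p := by
    intro q
    simp only [bregD_eq_sum_klTerm, ← sum_add_distrib]
    refine sum_congr rfl fun i _ => ?_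
    rw [klTerm_three_point (x := q i) (hp0 i) (hy0 i)]
    ring
  set A := ∑ i, (x i - p i) * (L i + 1 / η i * Real.log (p i / y i)) with hA
  suffices 0 ≤ A by rw [expand x]; linarith
  set B := ∑ i, 1 / η i * ((x i - p i) ^ 2 / p i) with hB
  have hB0 : 0 ≤ B := sum_nonneg fun i _ =>
    mul_nonneg (one_div_pos.2 (hη i)).le (div_nonneg (sq_nonneg _) (hp0 i).le)
  have key : ∀ h : ℝ, 0 < h → h ≤ 1 → 0 ≤ A + h * B := by
    intro h h0 h1
    have hz := convexCombo_mem_probSimplex hp hx h0.le h1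
    have hm := hmin _ hz
    rw [expand (fun i => (1 - h) * p i + h * x i)] at hm
    have hlin : ∑ i, ((1 - h) * p i + h * x i - p i) * (L i + 1 / η i * Real.log (p i / y i))
        = h * A := by
      rw [hA, mul_sum]; exact sum_congr rfl fun i _ => by ring
    have hquad : bregD η (fun i => (1 - h) * p i + h * x i) p ≤ h * (h * B) := by
      rw [bregD_eq_sum_klTerm, hB, mul_sum, mul_sum]
      refine sum_le_sum fun i _ => ?_
      refine (mul_le_mul_of_nonneg_left (klTerm_le_sq_div (hz.1 i) (hp0 i))
        (one_div_pos.2 (hη i)).le).trans (le_of_eq ?_)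
      ring
    rw [hlin] at hm
    have : 0 ≤ h * (A + h * B) := by linarith
    exact nonneg_of_mul_nonneg_right this h0
  by_contra hneg
  have hAneg : A < 0 := not_le.1 hneg
  have hk := key (min 1 (-A / (2 * (B + 1)))) (lt_min one_pos (div_pos (by linarith) (by linarith))) (min_le_left _ _)
  have hb : min 1 (-A / (2 * (B + 1))) * B ≤ -A / 2 := by
    calc _ ≤ (-A / (2 * (B + 1))) * (B + 1) := by
            apply mul_le_mul (min_le_right _ _) (by linarith) hB0
            exact div_nonneg (by linarith) (by linarith)
      _ = -A / 2 := by field_simp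
  linarith

lemma div_le_two_mul_sqrt_sub {a S b : ℝ} (ha : 0 ≤ a) (hS : 0 ≤ S) (hb : 0 < b)
    (h : √(S + a) ≤ b) : a / b ≤ 2 * (√(S + a) - √S) := by
  have hm : √S ≤ √(S + a) := Real.sqrt_le_sqrt (by linarith)
  have h1 := Real.sq_sqrt hS
  have h2 := Real.sq_sqrt (add_nonneg hS ha)
  rw [div_le_iff₀ hb]
  nlinarith [mul_nonneg (sub_nonneg.2 hm) (sub_nonneg.2 h),
    mul_nonneg (sub_nonneg.2 hm) (sub_nonneg.2 hm)]

section FTRL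

variable {K : ℕ} {β : ℝ} {p ℓ : ℕ → Fin K → ℝ}

lemma vSq_nonneg (t : ℕ) (i : Fin K) : 0 ≤ vSq p ℓ t i := sq_nonneg _

lemma vBar_nonneg {t : ℕ} (hp : p t ∈ probSimplex K) : 0 ≤ vBar p ℓ t :=
  sum_nonneg fun i _ => mul_nonneg (hp.1 i) (vSq_nonneg t i)

lemma sum_vSq_nonneg (n : ℕ) (i : Fin K) : 0 ≤ ∑ s ∈ Icc 1 n, vSq p ℓ s i :=
  sum_nonneg fun s _ => vSq_nonneg s i

lemma sum_mul_instReg {t : ℕ} (hp : p t ∈ probSimplex K) : ∑ i, p t i * instReg p ℓ t i = 0 := by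
  simp only [instReg, mul_sub, sum_sub_distrib, ← sum_mul, hp.2]
  ring

lemma bFTRL_nonneg (n : ℕ) (i : Fin K) : 0 ≤ bFTRL p ℓ n i := Real.sqrt_nonneg _

lemma bFTRL_zero (i : Fin K) : bFTRL p ℓ 0 i = 0 := by simp [bFTRL]

lemma bFTRL_sq (n : ℕ) (i : Fin K) : bFTRL p ℓ n i ^ 2
    = max (∑ s ∈ Icc 1 n, vBar p ℓ s) (∑ s ∈ Icc 1 n, vSq p ℓ s i) :=
  Real.sq_sqrt ((sum_vSq_nonneg n i).trans (le_max_right _ _))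

lemma sqrt_sum_vBar_le_bFTRL (n : ℕ) (i : Fin K) :
    √(∑ s ∈ Icc 1 n, vBar p ℓ s) ≤ bFTRL p ℓ n i := Real.sqrt_le_sqrt (le_max_left _ _)

lemma sqrt_sum_vSq_le_bFTRL (n : ℕ) (i : Fin K) :
    √(∑ s ∈ Icc 1 n, vSq p ℓ s i) ≤ bFTRL p ℓ n i := Real.sqrt_le_sqrt (le_max_right _ _)

lemma bFTRL_le_add (n : ℕ) (i : Fin K) : bFTRL p ℓ n i
    ≤ √(∑ s ∈ Icc 1 n, vSq p ℓ s i) + √(∑ s ∈ Icc 1 n, vBar p ℓ s) := by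
  unfold bFTRL
  rcases max_choice (∑ s ∈ Icc 1 n, vBar p ℓ s) (∑ s ∈ Icc 1 n, vSq p ℓ s i) with h | h <;>
    rw [h]
  · exact le_add_of_nonneg_left (Real.sqrt_nonneg _)
  · exact le_add_of_nonneg_right (Real.sqrt_nonneg _)

lemma bFTRL_le_succ {n : ℕ} (hv : 0 ≤ vBar p ℓ (n + 1)) (i : Fin K) :
    bFTRL p ℓ n i ≤ bFTRL p ℓ (n + 1) i := by
  unfold bFTRL
  rw [sum_Icc_succ_top (by omega), sum_Icc_succ_top (by omega)]
  exact Real.sqrt_le_sqrt (max_le_max (by linarith)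
    (by linarith [vSq_nonneg (p := p) (ℓ := ℓ) (n + 1) i]))

lemma bFTRL_succ_sub_le {n : ℕ} (hv : 0 ≤ vBar p ℓ (n + 1)) (i : Fin K)
    (hb : 0 < bFTRL p ℓ (n + 1) i) :
    bFTRL p ℓ (n + 1) i - bFTRL p ℓ n i
      ≤ (vBar p ℓ (n + 1) + vSq p ℓ (n + 1) i) / bFTRL p ℓ (n + 1) i := by
  have h1 := bFTRL_sq (p := p) (ℓ := ℓ) (n + 1) i
  have h0 := bFTRL_sq (p := p) (ℓ := ℓ) n i
  rw [sum_Icc_succ_top (by omega), sum_Icc_succ_top (by omega)] at h1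
  have hv' := vSq_nonneg (p := p) (ℓ := ℓ) (n + 1) i
  have hmax : bFTRL p ℓ (n + 1) i ^ 2
      ≤ bFTRL p ℓ n i ^ 2 + (vBar p ℓ (n + 1) + vSq p ℓ (n + 1) i) := by
    rw [h1, h0]
    refine max_le ?_ ?_
    · linarith [le_max_left (∑ s ∈ Icc 1 n, vBar p ℓ s) (∑ s ∈ Icc 1 n, vSq p ℓ s i)]
    · linarith [le_max_right (∑ s ∈ Icc 1 n, vBar p ℓ s) (∑ s ∈ Icc 1 n, vSq p ℓ s i)]
  rw [le_div_iff₀ hb]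
  nlinarith [mul_nonneg (bFTRL_nonneg (p := p) (ℓ := ℓ) n i)
    (sub_nonneg.2 (bFTRL_le_succ hv i))]

/-- The truncation and rescaling bias of the surrogate loss. -/
lemma abs_instReg_add_truncFTRL_le (hβ : 0 < β) {n : ℕ} (hv : 0 ≤ vBar p ℓ (n + 1)) (i : Fin K)
    (hb : 0 < bFTRL p ℓ (n + 1) i) :
    |instReg p ℓ (n + 1) i + truncFTRL β p ℓ (n + 1) i|
      ≤ (bFTRL p ℓ (n + 1) i - bFTRL p ℓ n i) / β
        + β * (vSq p ℓ (n + 1) i / bFTRL p ℓ (n + 1) i) := by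
  have hmono := sub_nonneg.2 (bFTRL_le_succ hv i)
  have hv' := vSq_nonneg (p := p) (ℓ := ℓ) (n + 1) i
  have hsq : vSq p ℓ (n + 1) i = |instReg p ℓ (n + 1) i| ^ 2 := (sq_abs _).symm
  unfold truncFTRL lrFTRL
  rw [one_div_div, Nat.add_sub_cancel]
  set r := instReg p ℓ (n + 1) i
  set b' := bFTRL p ℓ (n + 1) i
  set b := bFTRL p ℓ n i
  split_ifs with h
  · have he : r + -r * (b / b') = r * ((b' - b) / b') := by field_simp; ring
    rw [he, abs_mul, abs_of_nonneg (div_nonneg hmono hb.le)]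
    calc |r| * ((b' - b) / b') ≤ b' / β * ((b' - b) / b') :=
          mul_le_mul_of_nonneg_right h (div_nonneg hmono hb.le)
      _ = (b' - b) / β := by field_simp
      _ ≤ _ := le_add_of_nonneg_right (by positivity)
  · rw [add_zero]
    have h' : b' < |r| * β := (div_lt_iff₀ hβ).1 (not_le.1 h)
    refine le_add_of_nonneg_of_le (div_nonneg hmono hβ.le) ?_
    rw [hsq, ← mul_div_assoc, le_div_iff₀ hb]
    nlinarith [abs_nonneg r]

lemma truncFTRL_bounds (hβ : 0 < β) {n : ℕ} (i : Fin K)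
    (hb : 0 < bFTRL p ℓ n i) (hb' : bFTRL p ℓ n i ≤ bFTRL p ℓ (n + 1) i) :
    |truncFTRL β p ℓ (n + 1) i| ≤ bFTRL p ℓ n i / β ∧
      truncFTRL β p ℓ (n + 1) i ^ 2 / (bFTRL p ℓ n i / β)
        ≤ β * (vSq p ℓ (n + 1) i / bFTRL p ℓ (n + 1) i) := by
  have hv' := vSq_nonneg (p := p) (ℓ := ℓ) (n + 1) i
  have hsq : vSq p ℓ (n + 1) i = instReg p ℓ (n + 1) i ^ 2 := rfl
  have hb0 := hb.trans_le hb'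
  unfold truncFTRL lrFTRL
  rw [one_div_div, Nat.add_sub_cancel]
  set r := instReg p ℓ (n + 1) i
  set b' := bFTRL p ℓ (n + 1) i
  set b := bFTRL p ℓ n i
  split_ifs with h
  · constructor
    · rw [abs_mul, abs_neg, abs_of_pos (div_pos hb hb0)]
      calc |r| * (b / b') ≤ b' / β * (b / b') :=
            mul_le_mul_of_nonneg_right h (div_nonneg hb.le hb0.le)
        _ = b / β := by field_simp
    · rw [hsq]
      calc (-r * (b / b')) ^ 2 / (b / β) = β * (r ^ 2 / b') * (b / b') := by field_simp
        _ ≤ β * (r ^ 2 / b') * 1 :=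
            mul_le_mul_of_nonneg_left ((div_le_one hb0).2 hb') (by positivity)
        _ = _ := mul_one _
  · refine ⟨by rw [abs_zero]; positivity, ?_⟩
    rw [zero_pow two_ne_zero, zero_div]
    positivity

lemma vSq_div_bFTRL_le {n : ℕ} (i : Fin K) (hb : 0 < bFTRL p ℓ (n + 1) i) :
    vSq p ℓ (n + 1) i / bFTRL p ℓ (n + 1) i
      ≤ 2 * (√(∑ s ∈ Icc 1 (n + 1), vSq p ℓ s i) - √(∑ s ∈ Icc 1 n, vSq p ℓ s i)) := by
  have h := sqrt_sum_vSq_le_bFTRL (p := p) (ℓ := ℓ) (n + 1) i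
  rw [sum_Icc_succ_top (by omega)] at h ⊢
  exact div_le_two_mul_sqrt_sub (vSq_nonneg _ _) (sum_vSq_nonneg n i) hb h

lemma vBar_div_sqrt_le {n : ℕ} (hv : 0 ≤ vBar p ℓ (n + 1))
    (hW : 0 ≤ ∑ s ∈ Icc 1 n, vBar p ℓ s) (hpos : 0 < √(∑ s ∈ Icc 1 (n + 1), vBar p ℓ s)) :
    vBar p ℓ (n + 1) / √(∑ s ∈ Icc 1 (n + 1), vBar p ℓ s)
      ≤ 2 * (√(∑ s ∈ Icc 1 (n + 1), vBar p ℓ s) - √(∑ s ∈ Icc 1 n, vBar p ℓ s)) := by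
  rw [sum_Icc_succ_top (by omega)] at hpos ⊢
  exact div_le_two_mul_sqrt_sub hv hW hpos le_rfl

lemma sum_mul_vSq_div_bFTRL_le {n : ℕ} (hp : p (n + 1) ∈ probSimplex K)
    (hW : 0 ≤ ∑ s ∈ Icc 1 n, vBar p ℓ s) (hpos : 0 < √(∑ s ∈ Icc 1 (n + 1), vBar p ℓ s)) :
    ∑ i, p (n + 1) i * (vSq p ℓ (n + 1) i / bFTRL p ℓ (n + 1) i)
      ≤ 2 * (√(∑ s ∈ Icc 1 (n + 1), vBar p ℓ s) - √(∑ s ∈ Icc 1 n, vBar p ℓ s)) := by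
  refine le_trans ?_ (vBar_div_sqrt_le (vBar_nonneg hp) hW hpos)
  rw [vBar, sum_div]
  refine sum_le_sum fun i _ => ?_
  rw [mul_div_assoc]
  exact mul_le_mul_of_nonneg_left (div_le_div_of_nonneg_left (vSq_nonneg _ _) hpos
    (sqrt_sum_vBar_le_bFTRL _ _)) (hp.1 i)

lemma sum_mul_bFTRL_succ_sub_le {n : ℕ} (hp : p (n + 1) ∈ probSimplex K)
    (hW : 0 ≤ ∑ s ∈ Icc 1 n, vBar p ℓ s) (hpos : 0 < √(∑ s ∈ Icc 1 (n + 1), vBar p ℓ s)) :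
    ∑ i, p (n + 1) i * (bFTRL p ℓ (n + 1) i - bFTRL p ℓ n i)
      ≤ 4 * (√(∑ s ∈ Icc 1 (n + 1), vBar p ℓ s) - √(∑ s ∈ Icc 1 n, vBar p ℓ s)) := by
  have hv := vBar_nonneg (ℓ := ℓ) hp
  have h := vBar_div_sqrt_le hv hW hpos
  have hsum : ∑ i, p (n + 1) i * ((vBar p ℓ (n + 1) + vSq p ℓ (n + 1) i)
      / √(∑ s ∈ Icc 1 (n + 1), vBar p ℓ s))
      = 2 * (vBar p ℓ (n + 1) / √(∑ s ∈ Icc 1 (n + 1), vBar p ℓ s)) := by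
    simp only [← mul_div_assoc, ← sum_div, mul_add, sum_add_distrib, ← sum_mul, hp.2]
    rw [one_mul, two_mul]
    rfl
  have hle : ∑ i, p (n + 1) i * (bFTRL p ℓ (n + 1) i - bFTRL p ℓ n i)
      ≤ ∑ i, p (n + 1) i * ((vBar p ℓ (n + 1) + vSq p ℓ (n + 1) i)
        / √(∑ s ∈ Icc 1 (n + 1), vBar p ℓ s)) := by
    refine sum_le_sum fun i _ => mul_le_mul_of_nonneg_left ?_ (hp.1 i)
    have hsb := sqrt_sum_vBar_le_bFTRL (p := p) (ℓ := ℓ) (n + 1) i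
    exact (bFTRL_succ_sub_le hv i (hpos.trans_le hsb)).trans
      (div_le_div_of_nonneg_left (add_nonneg hv (vSq_nonneg _ _)) hpos hsb)
  linarith

/-- Passing from the true to the surrogate losses in a single round. -/
lemma instReg_succ_le (hβ : 0 < β) {n : ℕ} (hp : p (n + 1) ∈ probSimplex K)
    (hW : 0 ≤ ∑ s ∈ Icc 1 n, vBar p ℓ s) (hpos : 0 < √(∑ s ∈ Icc 1 (n + 1), vBar p ℓ s))
    (j : Fin K) :
    instReg p ℓ (n + 1) j
      ≤ ∑ i, p (n + 1) i * truncFTRL β p ℓ (n + 1) i - truncFTRL β p ℓ (n + 1) j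
        + (bFTRL p ℓ (n + 1) j - bFTRL p ℓ n j) / β
        + 2 * β * (√(∑ s ∈ Icc 1 (n + 1), vSq p ℓ s j) - √(∑ s ∈ Icc 1 n, vSq p ℓ s j))
        + (4 / β + 2 * β)
          * (√(∑ s ∈ Icc 1 (n + 1), vBar p ℓ s) - √(∑ s ∈ Icc 1 n, vBar p ℓ s)) := by
  have hv := vBar_nonneg (ℓ := ℓ) hp
  have hb : ∀ i, 0 < bFTRL p ℓ (n + 1) i := fun i =>
    hpos.trans_le (sqrt_sum_vBar_le_bFTRL _ _)
  have hj := (abs_le.1 (abs_instReg_add_truncFTRL_le hβ hv j (hb j))).2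
  have hj2 := mul_le_mul_of_nonneg_left (vSq_div_bFTRL_le j (hb j)) hβ.le
  have hsum : -∑ i, p (n + 1) i * truncFTRL β p ℓ (n + 1) i
      ≤ (∑ i, p (n + 1) i * (bFTRL p ℓ (n + 1) i - bFTRL p ℓ n i)) / β
        + β * ∑ i, p (n + 1) i * (vSq p ℓ (n + 1) i / bFTRL p ℓ (n + 1) i) := by
    have h0 := sum_mul_instReg (ℓ := ℓ) hp
    have he : -∑ i, p (n + 1) i * truncFTRL β p ℓ (n + 1) i
        = ∑ i, p (n + 1) i * -(instReg p ℓ (n + 1) i + truncFTRL β p ℓ (n + 1) i) := by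
      simp only [mul_neg, mul_add, sum_neg_distrib, sum_add_distrib, h0, zero_add]
    rw [he, sum_div, mul_sum, ← sum_add_distrib]
    refine sum_le_sum fun i _ => ?_
    have hi := mul_le_mul_of_nonneg_left ((neg_le_abs _).trans
      (abs_instReg_add_truncFTRL_le hβ hv i (hb i))) (hp.1 i)
    rw [mul_add, ← mul_div_assoc, mul_left_comm] at hi
    exact hi
  have h1 := div_le_div_of_nonneg_right (sum_mul_bFTRL_succ_sub_le hp hW hpos) hβ.le
  have h2 := mul_le_mul_of_nonneg_left (sum_mul_vSq_div_bFTRL_le hp hW hpos) hβ.le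
  have h3 : ∀ x : ℝ, (4 / β + 2 * β) * x = 4 * x / β + β * (2 * x) := fun x => by ring
  rw [h3]
  linarith

/-- The objective minimised by the FTRL iterate `p (n + 1)`. -/
def ftrlObj (β : ℝ) (p ℓ : ℕ → Fin K → ℝ) (n : ℕ) (q : Fin K → ℝ) : ℝ :=
  (∑ s ∈ Icc 1 n, ∑ i, q i * truncFTRL β p ℓ s i) + bregD (lrFTRL β p ℓ n) q (p 1)

lemma bregD_lrFTRL (n : ℕ) (x y : Fin K → ℝ) :
    bregD (lrFTRL β p ℓ n) x y = ∑ i, bFTRL p ℓ n i / β * klTerm (x i) (y i) := by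
  simp only [bregD_eq_sum_klTerm, lrFTRL, one_div_div]

lemma ftrlObj_zero (q : Fin K → ℝ) : ftrlObj β p ℓ 0 q = 0 := by
  simp [ftrlObj, bregD_lrFTRL, bFTRL_zero]

lemma ftrlObj_eq_sum_mul (n : ℕ) (q : Fin K → ℝ) : ftrlObj β p ℓ n q
    = ∑ i, q i * (∑ s ∈ Icc 1 n, truncFTRL β p ℓ s i) + bregD (lrFTRL β p ℓ n) q (p 1) := by
  simp only [ftrlObj, mul_sum]
  rw [sum_comm]

lemma ftrlObj_add_le_succ (hβ : 0 < β) (hp1 : ∀ i, 0 < p 1 i) {n : ℕ}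
    (hv : 0 ≤ vBar p ℓ (n + 1)) {x : Fin K → ℝ} (hx : x ∈ probSimplex K) :
    ftrlObj β p ℓ n x + ∑ i, x i * truncFTRL β p ℓ (n + 1) i ≤ ftrlObj β p ℓ (n + 1) x := by
  have h : bregD (lrFTRL β p ℓ n) x (p 1) ≤ bregD (lrFTRL β p ℓ (n + 1)) x (p 1) := by
    rw [bregD_lrFTRL, bregD_lrFTRL]
    exact sum_le_sum fun i _ => mul_le_mul_of_nonneg_right
      (div_le_div_of_nonneg_right (bFTRL_le_succ hv i) hβ.le) (klTerm_nonneg (hx.1 i) (hp1 i))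
  unfold ftrlObj
  rw [sum_Icc_succ_top (by omega)]
  linarith

/-- The one-round stability inequality for FTRL with increasing regularisers. -/
lemma ftrl_stability (hβ : 0 < β) (hp1 : ∀ i, 0 < p 1 i) (hp1s : p 1 ∈ probSimplex K) {n : ℕ}
    (hv : 0 ≤ vBar p ℓ (n + 1)) (hb : n ≠ 0 → ∀ i, 0 < bFTRL p ℓ n i)
    (hb' : ∀ i, 0 < bFTRL p ℓ (n + 1) i)
    (hp : p (n + 1) ∈ probSimplex K)
    (hmin : n ≠ 0 → ∀ q ∈ probSimplex K, ftrlObj β p ℓ n (p (n + 1)) ≤ ftrlObj β p ℓ n q)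
    {x : Fin K → ℝ} (hx : x ∈ probSimplex K) :
    ∑ i, p (n + 1) i * truncFTRL β p ℓ (n + 1) i + ftrlObj β p ℓ n (p (n + 1))
      ≤ ftrlObj β p ℓ (n + 1) x
        + β * ∑ i, p (n + 1) i * (vSq p ℓ (n + 1) i / bFTRL p ℓ (n + 1) i) := by
  have hmono := ftrlObj_add_le_succ (β := β) hβ hp1 hv hx
  rcases eq_or_ne n 0 with rfl | hn
  · have htr : ∀ i, truncFTRL β p ℓ (0 + 1) i = 0 := fun i => by
      simp [truncFTRL, bFTRL_zero]
    have hnn : 0 ≤ β * ∑ i, p (0 + 1) i * (vSq p ℓ (0 + 1) i / bFTRL p ℓ (0 + 1) i) :=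
      mul_nonneg hβ.le (sum_nonneg fun i _ => mul_nonneg (hp.1 i)
        (div_nonneg (vSq_nonneg _ _) (hb' i).le))
    simp only [htr, mul_zero, sum_const_zero, ftrlObj_zero] at hmono ⊢
    linarith
  · have hη : ∀ i, 0 < lrFTRL β p ℓ n i := fun i => div_pos hβ (hb hn i)
    have hmin' := hmin hn
    simp only [ftrlObj_eq_sum_mul] at hmin'
    have hpos := regularized_minimizer_pos hη hp1s hp1 hp hmin'
    have hopt := regularized_minimizer_bregD_le hη hp1 hp hpos hmin' hx
    rw [← ftrlObj_eq_sum_mul, ← ftrlObj_eq_sum_mul] at hopt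
    have hstab : ∑ i, (p (n + 1) i - x i) * truncFTRL β p ℓ (n + 1) i
        - bregD (lrFTRL β p ℓ n) x (p (n + 1))
        ≤ β * ∑ i, p (n + 1) i * (vSq p ℓ (n + 1) i / bFTRL p ℓ (n + 1) i) := by
      rw [bregD_lrFTRL, ← sum_sub_distrib, mul_sum]
      refine sum_le_sum fun i _ => ?_
      have ht := truncFTRL_bounds hβ i (hb hn i) (bFTRL_le_succ hv i)
      refine (linear_sub_klTerm_le (hpos i) (hx.1 i) (div_pos (hb hn i) hβ) ht.1).trans ?_
      rw [mul_left_comm β]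
      exact mul_le_mul_of_nonneg_left ht.2 (hpos i).le
    simp only [sub_mul, sum_sub_distrib] at hstab
    linarith

lemma bregD_lrFTRL_vertex (hp1 : ∀ i, p 1 i = 1 / K) (n : ℕ) (j : Fin K) :
    bregD (lrFTRL β p ℓ n) (Pi.single j 1) (p 1)
      = (Real.log K - 1) * (bFTRL p ℓ n j / β) + (1 / β) * (1 / K) * ∑ i, bFTRL p ℓ n i := by
  have hterm : ∀ i, bFTRL p ℓ n i / β * klTerm ((Pi.single j 1 : Fin K → ℝ) i) (p 1 i)
      = (if i = j then (Real.log K - 1) * (bFTRL p ℓ n j / β) else 0)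
        + (1 / β) * (1 / K) * bFTRL p ℓ n i := by
    intro i
    rw [hp1 i]
    split_ifs with h
    · subst h
      simp [klTerm]
      ring
    · simp [klTerm, Pi.single_eq_of_ne h]
      ring
  rw [bregD_lrFTRL, sum_congr rfl fun i _ => hterm i, sum_add_distrib, ← mul_sum]
  simp

end FTRL

theorem stmt_9 (K T : ℕ) (hK : 2 ≤ K) (hT : 2 ≤ T) (β : ℝ) (hβ : 0 < β)
    (ℓ p : ℕ → Fin K → ℝ)
    (hp1 : ∀ i, p 1 i = 1 / K)
    (hv1 : 0 < vBar p ℓ 1)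
    (hmin : ∀ t ∈ Finset.Icc 1 T,
      p (t + 1) ∈ probSimplex K ∧
      ∀ q ∈ probSimplex K,
        (∑ s ∈ Finset.Icc 1 t, ∑ i, p (t + 1) i * truncFTRL β p ℓ s i)
            + bregD (lrFTRL β p ℓ t) (p (t + 1)) (p 1)
          ≤ (∑ s ∈ Finset.Icc 1 t, ∑ i, q i * truncFTRL β p ℓ s i)
            + bregD (lrFTRL β p ℓ t) q (p 1)) :
    ∀ istar : Fin K,
      ∑ t ∈ Finset.Icc 1 T, ((∑ j, p t j * ℓ t j) - ℓ t istar)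
        ≤ (Real.log K / β + 2 * β)
            * Real.sqrt (∑ t ∈ Finset.Icc 1 T, vSq p ℓ t istar)
          + ((5 + Real.log K) / β + 5 * β)
            * Real.sqrt (∑ t ∈ Finset.Icc 1 T, vBar p ℓ t)
          + (1 / β) * (1 / K) * ∑ i, Real.sqrt (∑ t ∈ Finset.Icc 1 T, vSq p ℓ t i) := by
  intro j
  have hK0 : (0 : ℝ) < K := by exact_mod_cast (by omega : 0 < K)
  have hp1pos : ∀ i, 0 < p 1 i := fun i => by rw [hp1 i]; positivity
  have hp1s : p 1 ∈ probSimplex K := by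
    refine ⟨fun i => (hp1pos i).le, ?_⟩
    simp only [hp1, sum_const, card_univ, Fintype.card_fin, nsmul_eq_mul]
    field_simp
  have hmem : ∀ n ≤ T, p (n + 1) ∈ probSimplex K := by
    intro n hn
    rcases Nat.eq_zero_or_pos n with rfl | h
    · exact hp1s
    · exact (hmin n (mem_Icc.2 ⟨h, hn⟩)).1
  have hvnn : ∀ s ∈ Icc 1 T, 0 ≤ vBar p ℓ s := fun s hs => by
    obtain ⟨h1, h2⟩ := mem_Icc.1 hs
    obtain ⟨m, rfl⟩ := Nat.exists_eq_add_of_le' h1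
    exact vBar_nonneg (hmem m (by omega))
  have hW : ∀ n ≤ T, 0 ≤ ∑ s ∈ Icc 1 n, vBar p ℓ s := fun n hn =>
    sum_nonneg fun s hs => hvnn s (Icc_subset_Icc_right hn hs)
  have hWpos : ∀ n ≤ T, n ≠ 0 → 0 < √(∑ s ∈ Icc 1 n, vBar p ℓ s) := fun n hn h0 =>
    Real.sqrt_pos.2 (hv1.trans_le (single_le_sum
      (fun s hs => hvnn s (Icc_subset_Icc_right hn hs)) (mem_Icc.2 ⟨le_rfl, by omega⟩)))
  have hbpos : ∀ n ≤ T, n ≠ 0 → ∀ i, 0 < bFTRL p ℓ n i := fun n hn h0 i =>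
    (hWpos n hn h0).trans_le (sqrt_sum_vBar_le_bFTRL n i)
  have main : ∀ n ≤ T, ∑ t ∈ Icc 1 n, instReg p ℓ t j
      ≤ ftrlObj β p ℓ n (p (n + 1)) - ∑ s ∈ Icc 1 n, truncFTRL β p ℓ s j + bFTRL p ℓ n j / β
        + 2 * β * √(∑ s ∈ Icc 1 n, vSq p ℓ s j)
        + (4 / β + 4 * β) * √(∑ s ∈ Icc 1 n, vBar p ℓ s) := by
    intro n
    induction n with
    | zero => simp [ftrlObj_zero, bFTRL_zero]
    | succ n ih =>
      intro hn
      have hn' : n ≤ T := by omega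
      have hround := instReg_succ_le (ℓ := ℓ) hβ (hmem n hn') (hW n hn') (hWpos _ hn (by omega)) j
      have hstab := ftrl_stability (ℓ := ℓ) hβ hp1pos hp1s (vBar_nonneg (hmem n hn')) (hbpos n hn')
        (hbpos _ hn (by omega)) (hmem n hn')
        (fun h0 => (hmin n (mem_Icc.2 ⟨by omega, hn'⟩)).2) (hmem _ hn)
      have hv := mul_le_mul_of_nonneg_left
        (sum_mul_vSq_div_bFTRL_le (hmem n hn') (hW n hn') (hWpos _ hn (by omega))) hβ.le
      have ih := ih hn'
      rw [sum_Icc_succ_top (by omega) (f := fun t => instReg p ℓ t j),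
        sum_Icc_succ_top (by omega) (f := fun t => truncFTRL β p ℓ t j)]
      have hd : (bFTRL p ℓ (n + 1) j - bFTRL p ℓ n j) / β
          = bFTRL p ℓ (n + 1) j / β - bFTRL p ℓ n j / β := sub_div _ _ _
      linarith
  have hvert : (Pi.single j 1 : Fin K → ℝ) ∈ probSimplex K :=
    ⟨fun i => by by_cases h : i = j <;> simp [h], by simp⟩
  have hcomp : ftrlObj β p ℓ T (p (T + 1)) ≤ ∑ s ∈ Icc 1 T, truncFTRL β p ℓ s j
      + bregD (lrFTRL β p ℓ T) (Pi.single j 1) (p 1) := by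
    refine ((hmin T (mem_Icc.2 ⟨by omega, le_rfl⟩)).2 _ hvert).trans (le_of_eq ?_)
    simp [Pi.single_apply]
  rw [bregD_lrFTRL_vertex hp1] at hcomp
  have hbj := mul_le_mul_of_nonneg_left (bFTRL_le_add (p := p) (ℓ := ℓ) T j)
    (div_nonneg (Real.log_natCast_nonneg K) hβ.le)
  have hbsum : (1 / β) * (1 / K) * ∑ i, bFTRL p ℓ T i
      ≤ (1 / β) * (1 / K) * ∑ i, √(∑ t ∈ Icc 1 T, vSq p ℓ t i)
        + (1 / β) * √(∑ t ∈ Icc 1 T, vBar p ℓ t) := by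
    have h := mul_le_mul_of_nonneg_left
      (sum_le_sum fun i (_ : i ∈ univ) => bFTRL_le_add (p := p) (ℓ := ℓ) T i)
      (by positivity : 0 ≤ (1 / β) * (1 / (K : ℝ)))
    rw [sum_add_distrib, sum_const, card_univ, Fintype.card_fin, nsmul_eq_mul, mul_add] at h
    refine h.trans (le_of_eq ?_)
    field_simp
  have hslack : 0 ≤ β * √(∑ t ∈ Icc 1 T, vBar p ℓ t) := by positivity
  have hmain := main T le_rfl
  change ∑ t ∈ Icc 1 T, instReg p ℓ t j ≤ _
  linear_combination hmain + hcomp + hbj + hbsum + hslack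
end
end

section
/- Let K ≥ 1, let p ∈ ℝ^K with p(i) ≥ 0 for all i and Σ_{i=1}^K p(i) = 1, let z ∈ ℝ^K, y ∈ ℝ, and j ∈ [K]. Set ȳ = Σ_{i=1}^K p(i) z(i) and define ℓ(i) = z(i)·(ȳ − y) + (1/2)(z(i) − y)² for each i ∈ [K]. Then (ȳ − y)² − (z(j) − y)² ≤ (Σ_{i=1}^K p(i) ℓ(i) − ℓ(j)) − (1/2)(ȳ − z(j))² − (1/8)·Σ_{i=1}^K p(i)(z(i) − ȳ)². -/
/-- The mean surrogate loss splits into a function of the mean prediction and the variance. -/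
theorem sum_mul_surrogate_loss {ι : Type*} [Fintype ι] (p z : ι → ℝ) (hp : ∑ i, p i = 1)
    (m y : ℝ) (hm : ∑ i, p i * z i = m) :
    ∑ i, p i * (z i * (m - y) + (1 / 2) * (z i - y) ^ 2) =
      m * (m - y) + (1 / 2) * (m - y) ^ 2 + (1 / 2) * ∑ i, p i * (z i - m) ^ 2 := by
  have h : ∀ i, p i * (z i * (m - y) + (1 / 2) * (z i - y) ^ 2) =
      (1 / 2) * (p i * (z i - m) ^ 2) + 2 * (m - y) * (p i * z i)
        + (1 / 2) * (y ^ 2 - m ^ 2) * p i := fun i => by ring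
  simp_rw [h, Finset.sum_add_distrib, ← Finset.mul_sum, hp, hm]
  ring

theorem stmt_12 (K : ℕ) (hK : 1 ≤ K) (p z : Fin K → ℝ)
    (hp0 : ∀ i, 0 ≤ p i) (hp1 : ∑ i, p i = 1) (y : ℝ) (j : Fin K) :
    (∑ i, p i * z i - y) ^ 2 - (z j - y) ^ 2 ≤
      ((∑ i, p i * (z i * ((∑ k, p k * z k) - y) + (1 / 2) * (z i - y) ^ 2))
          - (z j * ((∑ k, p k * z k) - y) + (1 / 2) * (z j - y) ^ 2))
        - (1 / 2) * ((∑ i, p i * z i) - z j) ^ 2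
        - (1 / 8) * ∑ i, p i * (z i - ∑ k, p k * z k) ^ 2 := by
  rw [sum_mul_surrogate_loss p z hp1 _ y rfl]
  have hvar : 0 ≤ ∑ i, p i * (z i - ∑ k, p k * z k) ^ 2 :=
    Finset.sum_nonneg fun i _ => mul_nonneg (hp0 i) (sq_nonneg _)
  linarith
end

section
/- Let K ≥ 1, let p ∈ ℝ^K with p(i) ≥ 0 for all i and Σ_{i=1}^K p(i) = 1, let z ∈ ℝ^K and y ∈ ℝ. Set ȳ = Σ_{i=1}^K p(i) z(i) and define ℓ(i) = z(i)·(ȳ − y) + (1/2)(z(i) − y)². Then Σ_{i=1}^K p(i)·(ℓ(i) − Σ_{j=1}^K p(j) ℓ(j))² ≤ 6·(ȳ − y)²·Σ_{i=1}^K p(i)(z(i) − ȳ)² + 2·Σ_{i=1}^K p(i)(z(i) − ȳ)^4. -/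
/-- The weighted mean minimises the weighted sum of squared deviations. -/
theorem sum_mul_sub_mean_sq_le {ι : Type*} [Fintype ι] (p f : ι → ℝ) (hp : ∑ i, p i = 1)
    (c : ℝ) :
    ∑ i, p i * (f i - ∑ j, p j * f j) ^ 2 ≤ ∑ i, p i * (f i - c) ^ 2 := by
  set m := ∑ j, p j * f j with hm
  have h : ∑ i, p i * (f i - c) ^ 2 = ∑ i, p i * (f i - m) ^ 2 + (m - c) ^ 2 := by
    calc ∑ i, p i * (f i - c) ^ 2
        = ∑ i, (p i * (f i - m) ^ 2 + 2 * (m - c) * (p i * f i)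
            + p i * ((m - c) ^ 2 - 2 * (m - c) * m)) :=
          Finset.sum_congr rfl fun i _ => by ring
      _ = ∑ i, p i * (f i - m) ^ 2 + (m - c) ^ 2 := by
          rw [Finset.sum_add_distrib, Finset.sum_add_distrib, ← Finset.mul_sum,
            ← Finset.sum_mul, hp, ← hm]
          ring
  rw [h]
  exact le_add_of_nonneg_right (sq_nonneg _)

theorem stmt_14 (K : ℕ) (hK : 1 ≤ K) (p z : Fin K → ℝ)
    (hp0 : ∀ i, 0 ≤ p i) (hp1 : ∑ i, p i = 1) (y : ℝ) :
    (∑ i, p i *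
        ((z i * ((∑ k, p k * z k) - y) + (1 / 2) * (z i - y) ^ 2)
          - ∑ j, p j * (z j * ((∑ k, p k * z k) - y) + (1 / 2) * (z j - y) ^ 2)) ^ 2)
      ≤ 6 * ((∑ i, p i * z i) - y) ^ 2 * (∑ i, p i * (z i - ∑ k, p k * z k) ^ 2)
        + 2 * ∑ i, p i * (z i - ∑ k, p k * z k) ^ 4 := by
  generalize ∑ k, p k * z k = m
  refine (sum_mul_sub_mean_sq_le p (fun i => z i * (m - y) + (1 / 2) * (z i - y) ^ 2) hp1
    (m * (m - y) + (1 / 2) * (m - y) ^ 2)).trans ?_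
  rw [Finset.mul_sum, Finset.mul_sum, ← Finset.sum_add_distrib]
  refine Finset.sum_le_sum fun i _ => ?_
  have key : (z i * (m - y) + (1 / 2) * (z i - y) ^ 2
      - (m * (m - y) + (1 / 2) * (m - y) ^ 2)) ^ 2
      ≤ 6 * (m - y) ^ 2 * (z i - m) ^ 2 + 2 * (z i - m) ^ 4 := by
    linarith [mul_nonneg (sq_nonneg (z i - m)) (sq_nonneg (2 * (m - y) - (z i - m))),
      sq_nonneg ((z i - m) ^ 2)]
  calc _ ≤ p i * (6 * (m - y) ^ 2 * (z i - m) ^ 2 + 2 * (z i - m) ^ 4) :=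
        mul_le_mul_of_nonneg_left key (hp0 i)
    _ = _ := by ring
end

section
/- (Cost of mixing the comparator with the uniform distribution.) Let α ∈ (0, 1], i* ∈ [K], and set u = (1 − α)·e_{i*} + (α/K)·𝟙 ∈ P_α. Let ℓ_1, …, ℓ_T ∈ ℝ^K be arbitrary loss vectors and p_1, …, p_T ∈ P_α arbitrary predictions, and let ℓ̃_1, …, ℓ̃_T ∈ ℝ^K be any vectors satisfying ℓ̃_t(i)² ≤ v_t(i) for all t ∈ [T] and i ∈ [K]. Then Σ_{t=1}^T ⟨u − e_{i*}, ℓ̃_t⟩ ≤ √(αT)·(√(Σ_{t=1}^T v̄_t) + √(Σ_{t=1}^T v_t(i*))). -/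
open Finset

noncomputable section

/-- Cauchy–Schwarz for a sum whose terms satisfy `a t ^ 2 ≤ c * b t`. -/
theorem sum_le_sqrt_mul_sqrt_sum_of_sq_le {ι : Type*} (s : Finset ι) {c : ℝ} (hc : 0 ≤ c)
    {a b : ι → ℝ} (h : ∀ t ∈ s, a t ^ 2 ≤ c * b t) :
    ∑ t ∈ s, a t ≤ Real.sqrt (c * #s) * Real.sqrt (∑ t ∈ s, b t) := by
  rw [← Real.sqrt_mul (by positivity)]
  refine Real.le_sqrt_of_sq_le ?_
  calc (∑ t ∈ s, a t) ^ 2 ≤ #s * ∑ t ∈ s, a t ^ 2 := sq_sum_le_card_mul_sum_sq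
    _ ≤ #s * ∑ t ∈ s, c * b t := by gcongr with t ht; exact h t ht
    _ = c * #s * ∑ t ∈ s, b t := by rw [← mul_sum]; ring

/-- The squared uniform part of the comparator loss is controlled by `v̄_t`. -/
theorem sq_sum_uniform_mul_le_vBar {K : ℕ} (hK : K ≠ 0) {α : ℝ} (hα : 0 ≤ α)
    {p ℓ : ℕ → Fin K → ℝ} {t : ℕ} (hp : ∀ i, α / K ≤ p t i) {x : Fin K → ℝ}
    (hx : ∀ i, x i ^ 2 ≤ vSq p ℓ t i) :
    (∑ i, α / K * x i) ^ 2 ≤ α * vBar p ℓ t := by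
  have hK' : (K : ℝ) ≠ 0 := Nat.cast_ne_zero.mpr hK
  have hq : 0 ≤ α / K := by positivity
  calc (∑ i, α / K * x i) ^ 2 = (α / K) ^ 2 * (∑ i, x i) ^ 2 := by
        rw [← mul_sum, mul_pow]
    _ ≤ (α / K) ^ 2 * (K * ∑ i, x i ^ 2) := by
        gcongr
        simpa using sq_sum_le_card_mul_sum_sq (s := Finset.univ) (f := x)
    _ = α * ∑ i, α / K * x i ^ 2 := by
        rw [← mul_sum]; field_simp
    _ ≤ α * vBar p ℓ t := by
        unfold vBar
        gcongr with i
        · exact hq.trans (hp i)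
        · exact hp i
        · exact hx i

theorem stmt_19 (K T : ℕ) (hK : 2 ≤ K) (hT : 2 ≤ T) (α : ℝ)
    (hα : α ∈ Set.Ioc (0 : ℝ) 1) (istar : Fin K)
    (u : Fin K → ℝ)
    (hu : ∀ i, u i = (1 - α) * (if i = istar then 1 else 0) + α / K)
    (ℓ p : ℕ → Fin K → ℝ)
    (hp : ∀ t ∈ Finset.Icc 1 T, p t ∈ probSimplexTrunc K α)
    (ltil : ℕ → Fin K → ℝ)
    (hltil : ∀ t ∈ Finset.Icc 1 T, ∀ i, (ltil t i) ^ 2 ≤ vSq p ℓ t i) :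
    ∑ t ∈ Finset.Icc 1 T, ∑ i, (u i - (if i = istar then 1 else 0)) * ltil t i
      ≤ Real.sqrt (α * T) *
          (Real.sqrt (∑ t ∈ Finset.Icc 1 T, vBar p ℓ t)
            + Real.sqrt (∑ t ∈ Finset.Icc 1 T, vSq p ℓ t istar)) := by
  obtain ⟨h0, h1⟩ := hα
  have hsplit : ∀ t, ∑ i, (u i - (if i = istar then 1 else 0)) * ltil t i
      = (∑ i, α / K * ltil t i) + -α * ltil t istar := by
    intro t
    have hterm : ∀ i, (u i - (if i = istar then 1 else 0)) * ltil t i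
        = α / K * ltil t i + (if i = istar then -α * ltil t i else 0) := by
      intro i
      rw [hu]
      split_ifs <;> ring
    simp only [hterm, sum_add_distrib, sum_ite_eq', mem_univ, if_true]
  simp only [hsplit, sum_add_distrib, mul_add]
  have huniform := sum_le_sqrt_mul_sqrt_sum_of_sq_le (Finset.Icc 1 T) h0.le
    fun t ht => sq_sum_uniform_mul_le_vBar (by omega) h0.le (hp t ht).2 (hltil t ht)
  have hstar := sum_le_sqrt_mul_sqrt_sum_of_sq_le (Finset.Icc 1 T) h0.le
    (a := fun t => -α * ltil t istar) (b := fun t => vSq p ℓ t istar) fun t ht => by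
      have hv := hltil t ht istar
      calc (-α * ltil t istar) ^ 2 = α * (α * ltil t istar ^ 2) := by ring
        _ ≤ α * (1 * vSq p ℓ t istar) := by gcongr
        _ = α * vSq p ℓ t istar := by ring
  rw [Nat.card_Icc, Nat.add_sub_cancel] at huniform hstar
  exact add_le_add huniform hstar
end
end
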